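/- Let h ∈ C[x_0,x_1,x_2,x_3] be homogeneous of degree 4, not a square, set f_4 = x_4^2 − h, and let g_3 ∈ C[x_0,...,x_4] be nonzero and homogeneous of weighted degree 3 for the weights (1,1,1,1,2). For every t ∈ C with t ≠ 0, the degree-zero homogeneous fraction field K_0(C[x_0,...,x_5]/(f_4 + t·g_3·x_5)), taken with respect to the weights (1,1,1,1,2,1), is isomorphic as a C-algebra to the rational function field C(y_1,y_2,y_3,y_4) in four variables. (This is Lemma 2.2(2): the fibers X_t for t ≠ 0 are rational fourfolds.) -/

import Mathlib

/-!
Formalization of statements from "Rationality does not specialize among terminal fourfolds"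
(A. Perry). We work over `ℂ`. The weighted projective space `P(1,1,1,1,2)` has homogeneous
coordinate ring `ℂ[x₀,…,x₄] = MvPolynomial (Fin 5) ℂ` with weights `w5 = (1,1,1,1,2)`, and
`P(1,1,1,1,2,1)` has coordinate ring `MvPolynomial (Fin 6) ℂ` with weights `w6 = (1,1,1,1,2,1)`.
-/

noncomputable section
open MvPolynomial

/-- The weights `(1,1,1,1,2)` of the weighted projective space `P(1,1,1,1,2)`. -/
def w5 : Fin 5 → ℕ := ![1, 1, 1, 1, 2]

/-- The weights `(1,1,1,1,2,1)` of the weighted projective space `P(1,1,1,1,2,1)`. -/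
def w6 : Fin 6 → ℕ := ![1, 1, 1, 1, 2, 1]

/-- The polynomial `f₄ = x₄² − h(x₀,x₁,x₂,x₃) ∈ ℂ[x₀,…,x₄]` cutting out the quartic
double solid `Y ⊂ P(1,1,1,1,2)`. -/
def f4 (h : MvPolynomial (Fin 4) ℂ) : MvPolynomial (Fin 5) ℂ :=
  X 4 ^ 2 - rename Fin.castSucc h

/-- The degree-zero homogeneous fraction field `K₀(A)` of an `ℕ`-graded `ℂ`-algebra `A`,
as a subalgebra of `FractionRing A`: it consists of `0` together with all fractions `a/b`
where `a, b` are homogeneous elements of `A` of the same degree with `b` nonzero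
(a nonzerodivisor).  Here `Hom a d` is the predicate "`a` is homogeneous of degree `d`";
the hypotheses `h1`, `hmul`, `hadd` record that constants are homogeneous of degree `0`,
that products of homogeneous elements are homogeneous of the sum of the degrees, and that
sums of homogeneous elements of the same degree are homogeneous. -/
def K0 {A : Type*} [CommRing A] [Algebra ℂ A] (Hom : A → ℕ → Prop)
    (h1 : ∀ c : ℂ, Hom (algebraMap ℂ A c) 0)
    (hmul : ∀ {a b : A} {d e : ℕ}, Hom a d → Hom b e → Hom (a * b) (d + e))
    (hadd : ∀ {a b : A} {d : ℕ}, Hom a d → Hom b d → Hom (a + b) d) :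
    Subalgebra ℂ (FractionRing A) where
  carrier := {z | z = 0 ∨ ∃ a b : A, ∃ d : ℕ, Hom a d ∧ Hom b d ∧ b ∈ nonZeroDivisors A ∧
      z * algebraMap A (FractionRing A) b = algebraMap A (FractionRing A) a}
  mul_mem' := by
    rintro z₁ z₂ (rfl | ⟨a₁, b₁, d₁, ha₁, hb₁, hb₁0, e₁⟩) h₂
    · left; rw [zero_mul]
    rcases h₂ with rfl | ⟨a₂, b₂, d₂, ha₂, hb₂, hb₂0, e₂⟩
    · left; rw [mul_zero]
    right
    exact ⟨a₁ * a₂, b₁ * b₂, d₁ + d₂, hmul ha₁ ha₂, hmul hb₁ hb₂, mul_mem hb₁0 hb₂0, by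
      rw [map_mul, map_mul]
      linear_combination (z₂ * algebraMap A (FractionRing A) b₂) * e₁
        + algebraMap A (FractionRing A) a₁ * e₂⟩
  one_mem' := by
    right
    refine ⟨1, 1, 0, ?_, ?_, one_mem _, by simp⟩ <;> simpa using h1 1
  add_mem' := by
    rintro z₁ z₂ (rfl | ⟨a₁, b₁, d₁, ha₁, hb₁, hb₁0, e₁⟩) h₂
    · rw [zero_add]; exact h₂
    rcases h₂ with rfl | ⟨a₂, b₂, d₂, ha₂, hb₂, hb₂0, e₂⟩
    · rw [add_zero]; right; exact ⟨a₁, b₁, d₁, ha₁, hb₁, hb₁0, e₁⟩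
    right
    refine ⟨a₁ * b₂ + b₁ * a₂, b₁ * b₂, d₁ + d₂, hadd (hmul ha₁ hb₂) (hmul hb₁ ha₂),
      hmul hb₁ hb₂, mul_mem hb₁0 hb₂0, ?_⟩
    rw [map_mul, map_add, map_mul, map_mul]
    linear_combination algebraMap A (FractionRing A) b₂ * e₁
      + algebraMap A (FractionRing A) b₁ * e₂
  zero_mem' := Or.inl rfl
  algebraMap_mem' := fun c => by
    right
    exact ⟨algebraMap ℂ A c, 1, 0, h1 c, by simpa using h1 1, one_mem _, by
      simp [IsScalarTower.algebraMap_apply ℂ A (FractionRing A)]⟩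

/-- Homogeneity of degree `d` in the quotient of `ℂ[x₀,…,x_{n-1}]` (weighted by `w`)
by the ideal generated by `f`: an element is homogeneous of degree `d` iff it is the image
of a weighted-homogeneous polynomial of weighted degree `d`. -/
def HomQuot {n : ℕ} (w : Fin n → ℕ) (f : MvPolynomial (Fin n) ℂ)
    (a : MvPolynomial (Fin n) ℂ ⧸ Ideal.span {f}) (d : ℕ) : Prop :=
  ∃ p : MvPolynomial (Fin n) ℂ, p.IsWeightedHomogeneous w d ∧ Ideal.Quotient.mk _ p = a

theorem HomQuot.h1 {n : ℕ} (w : Fin n → ℕ) (f : MvPolynomial (Fin n) ℂ) (c : ℂ) :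
    HomQuot w f (algebraMap ℂ _ c) 0 :=
  ⟨C c, isWeightedHomogeneous_C w c, rfl⟩

theorem HomQuot.mul {n : ℕ} {w : Fin n → ℕ} {f : MvPolynomial (Fin n) ℂ}
    {a b : MvPolynomial (Fin n) ℂ ⧸ Ideal.span {f}} {d e : ℕ}
    (ha : HomQuot w f a d) (hb : HomQuot w f b e) : HomQuot w f (a * b) (d + e) := by
  obtain ⟨p, hp, rfl⟩ := ha
  obtain ⟨q, hq, rfl⟩ := hb
  exact ⟨p * q, hp.mul hq, map_mul _ _ _⟩

theorem HomQuot.add {n : ℕ} {w : Fin n → ℕ} {f : MvPolynomial (Fin n) ℂ}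
    {a b : MvPolynomial (Fin n) ℂ ⧸ Ideal.span {f}} {d : ℕ}
    (ha : HomQuot w f a d) (hb : HomQuot w f b d) : HomQuot w f (a + b) d := by
  obtain ⟨p, hp, rfl⟩ := ha
  obtain ⟨q, hq, rfl⟩ := hb
  refine ⟨p + q, ?_, map_add _ _ _⟩
  rw [← mem_weightedHomogeneousSubmodule] at hp hq ⊢
  exact Submodule.add_mem _ hp hq

/-- The degree-zero homogeneous fraction field of `ℂ[x₀,…,x_{n-1}]/(f)` with respect to the
weights `w`; when `f` is irreducible and weighted-homogeneous this is the function field of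
the hypersurface `{f = 0}` in the weighted projective space `P(w)`. -/
abbrev K0Quot {n : ℕ} (w : Fin n → ℕ) (f : MvPolynomial (Fin n) ℂ) :
    Subalgebra ℂ (FractionRing (MvPolynomial (Fin n) ℂ ⧸ Ideal.span {f})) :=
  K0 (HomQuot w f) (HomQuot.h1 w f) (fun ha hb => ha.mul hb) (fun ha hb => ha.add hb)

instance K0.instCommRingSubtype {A : Type*} [CommRing A] [Algebra ℂ A]
    (Hom : A → ℕ → Prop) (h1 : ∀ c : ℂ, Hom (algebraMap ℂ A c) 0)
    (hmul : ∀ {a b : A} {d e : ℕ}, Hom a d → Hom b e → Hom (a * b) (d + e))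
    (hadd : ∀ {a b : A} {d : ℕ}, Hom a d → Hom b d → Hom (a + b) d) :
    CommRing ↥(K0 Hom h1 hmul hadd) :=
  inferInstance

instance K0.instAlgebraSubtype {A : Type*} [CommRing A] [Algebra ℂ A]
    (Hom : A → ℕ → Prop) (h1 : ∀ c : ℂ, Hom (algebraMap ℂ A c) 0)
    (hmul : ∀ {a b : A} {d e : ℕ}, Hom a d → Hom b e → Hom (a * b) (d + e))
    (hadd : ∀ {a b : A} {d : ℕ}, Hom a d → Hom b d → Hom (a + b) d) :
    Algebra ℂ ↥(K0 Hom h1 hmul hadd) :=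
  inferInstance

set_option synthInstance.maxHeartbeats 400000
set_option maxHeartbeats 1000000

/-- The polynomial `f₄ + t·g₃·x₅ ∈ ℂ[x₀,…,x₅]` cutting out the fiber
`X_t ⊂ P(1,1,1,1,2,1)` of the family of fourfolds. -/
def famPoly (h : MvPolynomial (Fin 4) ℂ) (g3 : MvPolynomial (Fin 5) ℂ) (t : ℂ) :
    MvPolynomial (Fin 6) ℂ :=
  rename Fin.castSucc (f4 h) + C t * rename Fin.castSucc g3 * X 5

theorem scaling {σ M : Type*} [CommRing M] [Algebra ℂ M] {w : σ → ℕ} {d : ℕ}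
    {p : MvPolynomial σ ℂ} (hp : p.IsWeightedHomogeneous w d) (c : M) (v : σ → M) :
    aeval (fun i => c ^ w i * v i) p = c ^ d * aeval v p := by
  rw [aeval_def, aeval_def, eval₂_eq, eval₂_eq, Finset.mul_sum]
  refine Finset.sum_congr rfl fun m hm => ?_
  have hw := hp (mem_support_iff.mp hm)
  have : ∏ i ∈ m.support, (c ^ w i * v i) ^ m i = c ^ d * ∏ i ∈ m.support, v i ^ m i := by
    simp_rw [mul_pow]
    rw [Finset.prod_mul_distrib, ← hw, Finsupp.weight_apply, Finsupp.sum,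
      ← Finset.prod_pow_eq_pow_sum]
    congr 1
    refine Finset.prod_congr rfl fun i _ => ?_
    rw [← pow_mul, smul_eq_mul, mul_comm]
  rw [this]; ring

def lastEquiv (n : ℕ) :
    MvPolynomial (Fin (n + 1)) ℂ ≃ₐ[ℂ] Polynomial (MvPolynomial (Fin n) ℂ) :=
  (renameEquiv ℂ finSuccEquivLast).trans (optionEquivLeft ℂ (Fin n))

theorem lastEquiv_rename (n : ℕ) (p : MvPolynomial (Fin n) ℂ) :
    lastEquiv n (rename Fin.castSucc p) = Polynomial.C p := by
  induction p using MvPolynomial.induction_on with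
  | C a => simp [lastEquiv]
  | add p q hp hq => simp only [map_add, hp, hq]
  | mul_X p i hp => simp only [map_mul, hp]; simp [lastEquiv]

theorem lastEquiv_X (n : ℕ) : lastEquiv n (X (Fin.last n)) = Polynomial.X := by
  simp [lastEquiv]

theorem prime_f4 (h : MvPolynomial (Fin 4) ℂ)
    (hsq : ¬ ∃ q : MvPolynomial (Fin 4) ℂ, h = q ^ 2) : Prime (f4 h) := by
  have e : lastEquiv 4 (f4 h) = Polynomial.X ^ 2 - Polynomial.C h := by
    rw [f4, map_sub, map_pow, lastEquiv_rename]
    congr 2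
    exact lastEquiv_X 4
  rw [← MulEquiv.prime_iff (lastEquiv 4).toMulEquiv]
  change Prime (lastEquiv 4 (f4 h))
  rw [e, ← UniqueFactorizationMonoid.irreducible_iff_prime]
  have hd : (Polynomial.X ^ 2 - Polynomial.C h).natDegree = 2 :=
    Polynomial.natDegree_X_pow_sub_C
  have hm : (Polynomial.X ^ 2 - Polynomial.C h).Monic :=
    Polynomial.monic_X_pow_sub_C h two_ne_zero
  rw [hm.irreducible_iff_roots_eq_zero_of_degree_le_three (by rw [hd]) (by rw [hd]; norm_num)]
  rw [Multiset.eq_zero_iff_forall_notMem]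
  intro q hq
  rw [Polynomial.mem_roots'] at hq
  have := hq.2
  simp only [Polynomial.IsRoot, Polynomial.eval_sub, Polynomial.eval_pow, Polynomial.eval_X,
    Polynomial.eval_C] at this
  exact hsq ⟨q, (sub_eq_zero.mp this).symm⟩

theorem f4_hom (h : MvPolynomial (Fin 4) ℂ) (hh : h.IsHomogeneous 4) {M : Type*} [CommRing M]
    [Algebra ℂ M] (c : M) (v : Fin 5 → M) :
    aeval (fun i => c ^ w5 i * v i) (f4 h) = c ^ 4 * aeval v (f4 h) := by
  have := scaling hh c (v ∘ Fin.castSucc)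
  have e : ((fun i => c ^ w5 i * v i) ∘ Fin.castSucc) =
      fun i : Fin 4 => c ^ ((1 : Fin 4 → ℕ) i) * (v ∘ Fin.castSucc) i := by
    funext i; fin_cases i <;> simp [w5]
  have e4 : w5 4 = 2 := rfl
  simp only [f4, map_sub, map_pow, aeval_X, aeval_rename]
  rw [e, this, e4]; ring

theorem not_dvd_aux (h : MvPolynomial (Fin 4) ℂ) (hh : h.IsHomogeneous 4)
    (g3 : MvPolynomial (Fin 5) ℂ) (hg3 : g3 ≠ 0) (hg3hom : g3.IsWeightedHomogeneous w5 3)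
    {M : Type*} [CommRing M] [IsDomain M] [Algebra ℂ M] (T : M) (hT : T ≠ 0) (v : Fin 5 → M)
    (ev : M →+* MvPolynomial (Fin 5) ℂ) (hev : ev T = 0) (hv : ∀ p, ev (aeval v p) = p) :
    ¬ f4 h ∣ g3 := by
  rintro ⟨q, hq⟩
  have h1 : T ^ 3 * aeval v g3 =
      T ^ 4 * aeval v (f4 h) * aeval (fun i => T ^ w5 i * v i) q := by
    rw [← scaling hg3hom, ← f4_hom h hh, ← map_mul, ← hq]
  have h2 : aeval v g3 = T * (aeval v (f4 h) * aeval (fun i => T ^ w5 i * v i) q) := by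
    apply mul_left_cancel₀ (pow_ne_zero 3 hT)
    rw [h1]; ring
  have h3 := congrArg ev h2
  rw [hv, map_mul, hev, zero_mul] at h3
  exact hg3 h3

theorem not_dvd (h : MvPolynomial (Fin 4) ℂ) (hh : h.IsHomogeneous 4)
    (g3 : MvPolynomial (Fin 5) ℂ) (hg3 : g3 ≠ 0) (hg3hom : g3.IsWeightedHomogeneous w5 3) :
    ¬ f4 h ∣ g3 := by
  refine not_dvd_aux h hh g3 hg3 hg3hom (M := Polynomial (MvPolynomial (Fin 5) ℂ))
    Polynomial.X Polynomial.X_ne_zero (fun i => Polynomial.C (X i)) (Polynomial.evalRingHom 0)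
    Polynomial.eval_X (fun p => ?_)
  induction p using MvPolynomial.induction_on with
  | C a => rw [aeval_C]; exact Polynomial.eval_C
  | add p q hp hq => rw [map_add, map_add, hp, hq]
  | mul_X p i hp =>
    rw [map_mul, map_mul, hp, aeval_X]
    congr 1
    exact Polynomial.eval_C

theorem prime_fam (h : MvPolynomial (Fin 4) ℂ) (hh : h.IsHomogeneous 4)
    (hsq : ¬ ∃ q : MvPolynomial (Fin 4) ℂ, h = q ^ 2)
    (g3 : MvPolynomial (Fin 5) ℂ) (hg3 : g3 ≠ 0) (hg3hom : g3.IsWeightedHomogeneous w5 3)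
    (t : ℂ) (ht : t ≠ 0) : Prime (famPoly h g3 t) := by
  have hv : ∀ p : MvPolynomial (Fin 5) ℂ, (5 : Fin 6) ∉ (rename Fin.castSucc p).vars := by
    intro p hp
    classical
    have := vars_rename Fin.castSucc p hp
    rw [Finset.mem_image] at this
    obtain ⟨i, _, hi⟩ := this
    exact Fin.castSucc_ne_last i hi
  have hinj := rename_injective (R := ℂ) _ (Fin.castSucc_injective 5)
  have hP : Prime (rename Fin.castSucc (f4 h) : MvPolynomial (Fin 6) ℂ) := by
    rw [← MulEquiv.prime_iff (lastEquiv 5).toMulEquiv]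
    change Prime (lastEquiv 5 _)
    rw [lastEquiv_rename, Polynomial.prime_C_iff]
    exact prime_f4 h hsq
  have e : C t * rename Fin.castSucc g3 =
      (rename Fin.castSucc (C t * g3) : MvPolynomial (Fin 6) ℂ) := by simp
  rw [← UniqueFactorizationMonoid.irreducible_iff_prime, famPoly, add_comm, e]
  have ht' : (C t : MvPolynomial (Fin 5) ℂ) ≠ 0 := by simpa using ht
  refine irreducible_mul_X_add _ _ _ ?_ (hv _) (hv _) ?_
  · rw [Ne, map_eq_zero_iff _ hinj]
    exact mul_ne_zero ht' hg3
  · refine IsRelPrime.symm (hP.irreducible.isRelPrime_iff_not_dvd.mpr fun hd => ?_)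
    have := map_dvd (killCompl (R := ℂ) (Fin.castSucc_injective 5)) hd
    rw [killCompl_rename_app, killCompl_rename_app] at this
    exact not_dvd h hh _ (mul_ne_zero ht' hg3) (hg3hom.C_mul t) this

/-- Dehomogenization `x₀ = 1`. -/
def dehom : MvPolynomial (Fin 5) ℂ →ₐ[ℂ] MvPolynomial (Fin 4) ℂ :=
  aeval (Fin.cons 1 X : Fin 5 → MvPolynomial (Fin 4) ℂ)

theorem aeval_dehom {M : Type*} [Field M] [Algebra ℂ M] (u : Fin 5 → M) (h0 : u 0 = 1)
    (P : MvPolynomial (Fin 5) ℂ) : aeval (fun i => u (Fin.succ i)) (dehom P) = aeval u P := by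
  have : (aeval (fun i => u (Fin.succ i))).comp dehom = aeval (R := ℂ) u := by
    ext i
    refine Fin.cases ?_ (fun i => ?_) i <;> simp [dehom, h0]
  rw [← this]; rfl

theorem scaling_div {n : ℕ} {M : Type*} [Field M] [Algebra ℂ M] {w : Fin n → ℕ} {d : ℕ}
    {p : MvPolynomial (Fin n) ℂ} (hp : p.IsWeightedHomogeneous w d) (c : M) (hc : c ≠ 0)
    (ξ : Fin n → M) : aeval ξ p = c ^ d * aeval (fun i => ξ i / c ^ w i) p := by
  rw [← scaling hp]
  congr 1
  congr 1
  funext i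
  field_simp

theorem dehom_ne_zero (g : MvPolynomial (Fin 5) ℂ) (hg : g ≠ 0) {d : ℕ}
    (hgh : g.IsWeightedHomogeneous w5 d) : dehom g ≠ 0 := by
  intro h0
  let M := FractionRing (MvPolynomial (Fin 5) ℂ)
  let ι : MvPolynomial (Fin 5) ℂ →ₐ[ℂ] M := IsScalarTower.toAlgHom ℂ _ M
  have hι : Function.Injective ι := IsFractionRing.injective _ M
  have hx : ι (X 0) ≠ 0 := by
    rw [Ne, map_eq_zero_iff _ hι]; exact X_ne_zero 0
  have h1 := scaling_div hgh (ι (X 0)) hx (fun i => ι (X i))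
  have h2 : ι (X 0) / ι (X 0) ^ w5 0 = 1 := by
    rw [show w5 0 = 1 from rfl, pow_one]; exact div_self hx
  rw [← aeval_dehom (fun i => ι (X i) / ι (X 0) ^ w5 i) h2, h0, map_zero, mul_zero] at h1
  have : aeval (fun i => ι (X i)) = ι := by ext i; simp
  rw [this, map_eq_zero_iff _ hι] at h1
  exact hg h1

theorem clear_den {M : Type*} [Field M] [Algebra ℂ M] (ξ : Fin 5 → M) (h0 : ξ 0 ≠ 0)
    (p : MvPolynomial (Fin 4) ℂ) : ∃ (N : ℕ) (P : MvPolynomial (Fin 5) ℂ),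
      aeval ξ P = ξ 0 ^ N * aeval (fun i : Fin 4 => ξ i.succ / ξ 0 ^ w5 i.succ) p ∧
      dehom P = p := by
  have hX : dehom (X 0) = 1 := by simp [dehom]
  induction p using MvPolynomial.induction_on with
  | C a => exact ⟨0, C a, by simp, by simp [dehom]⟩
  | add p q hp hq =>
    obtain ⟨N, P, h1, h2⟩ := hp
    obtain ⟨N', P', h1', h2'⟩ := hq
    refine ⟨N + N', X 0 ^ N' * P + X 0 ^ N * P', ?_, ?_⟩
    · simp only [map_add, map_mul, map_pow, aeval_X, h1, h1']; ring
    · simp only [map_add, map_mul, map_pow, hX, h2, h2']; ring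
  | mul_X p i hp =>
    obtain ⟨N, P, h1, h2⟩ := hp
    refine ⟨N + w5 i.succ, P * X i.succ, ?_, ?_⟩
    · simp only [map_mul, aeval_X, h1]; field_simp; ring
    · rw [map_mul, h2]; simp [dehom]

theorem neg_div_cancel {K : Type*} [Field K] (a b : K) (hb : b ≠ 0) : a + b * (-a / b) = 0 := by
  field_simp; ring

theorem core (h : MvPolynomial (Fin 4) ℂ)
    (g3 : MvPolynomial (Fin 5) ℂ) (hg3 : g3 ≠ 0) (hg3hom : g3.IsWeightedHomogeneous w5 3)
    (t : ℂ) (ht : t ≠ 0) {M : Type*} [Field M] [Algebra ℂ M] (ξ : Fin 6 → M)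
    (hrel : aeval ξ (famPoly h g3 t) = 0) (hh : h.IsHomogeneous 4)
    (hker : ∀ P : MvPolynomial (Fin 6) ℂ, aeval ξ P = 0 → famPoly h g3 t ∣ P) :
    ∃ φ : FractionRing (MvPolynomial (Fin 4) ℂ) →ₐ[ℂ] M, ∀ z, z ∈ φ.range ↔
      ∃ (p q : MvPolynomial (Fin 6) ℂ) (d : ℕ), p.IsWeightedHomogeneous w6 d ∧
        q.IsWeightedHomogeneous w6 d ∧ aeval ξ q ≠ 0 ∧ z * aeval ξ q = aeval ξ p := by
  let L := FractionRing (MvPolynomial (Fin 4) ℂ)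
  let ι : MvPolynomial (Fin 4) ℂ →ₐ[ℂ] L := IsScalarTower.toAlgHom ℂ _ L
  have hι : Function.Injective ι := IsFractionRing.injective _ L
  -- the map to `L`
  have hgL : ι (dehom g3) ≠ 0 := by
    rw [Ne, map_eq_zero_iff _ hι]; exact dehom_ne_zero g3 hg3 hg3hom
  have htL : algebraMap ℂ L t ≠ 0 := by simpa using ht
  let s : L := - ι (dehom (f4 h)) / (algebraMap ℂ L t * ι (dehom g3))
  let τ : MvPolynomial (Fin 6) ℂ →ₐ[ℂ] L :=
    aeval (Fin.snoc (α := fun _ => L) (fun i : Fin 5 => ι (dehom (X i))) s)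
  have hτr : ∀ P, τ (rename Fin.castSucc P) = ι (dehom P) := by
    intro P
    have : τ.comp (rename Fin.castSucc) = ι.comp dehom := by
      ext i; simp [τ]
    exact DFunLike.congr_fun this P
  have hτ5 : τ (X 5) = s := by
    change τ (X (Fin.last 5)) = s
    exact (aeval_X _ _).trans (Fin.snoc_last (α := fun _ => L) _ _)
  have hs : ι (dehom (f4 h)) + algebraMap ℂ L t * ι (dehom g3) * s = 0 :=
    neg_div_cancel _ _ (mul_ne_zero htL hgL)
  have hτF : τ (famPoly h g3 t) = 0 := by
    have hC : τ (C t) = algebraMap ℂ L t := τ.commutes t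
    rw [famPoly, map_add, map_mul, map_mul, hτr, hτr, hτ5, hC]
    exact hs
  have hξ : ∀ P : MvPolynomial (Fin 5) ℂ, aeval ξ (rename Fin.castSucc P) =
      aeval (fun i : Fin 5 => ξ i.castSucc) P := fun P => by
    rw [aeval_rename]; rfl
  have h0 : ξ 0 ≠ 0 := by
    intro h0
    have := map_dvd τ (hker (X 0) (by simpa using h0))
    rw [hτF, zero_dvd_iff] at this
    have h1 := hτr (X 0)
    rw [rename_X] at h1
    change τ (X 0) = _ at h1
    rw [h1] at this
    simp [dehom] at this
  let u : Fin 6 → M := fun i => ξ i / ξ 0 ^ w6 i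
  let u5 : Fin 5 → M := fun i => ξ i.castSucc / ξ 0 ^ w5 i
  have hu5 : ∀ i : Fin 5, u i.castSucc = u5 i := by
    intro i; fin_cases i <;> rfl
  have hu50 : u5 0 = 1 := by simp [u5, w5, h0]
  let σ : MvPolynomial (Fin 4) ℂ →ₐ[ℂ] M := aeval (fun i : Fin 4 => u5 i.succ)
  have hσ : Function.Injective σ := by
    rw [injective_iff_map_eq_zero]
    intro p hp
    obtain ⟨N, P, h1, h2⟩ := clear_den (fun i : Fin 5 => ξ i.castSucc) h0 p
    have h3 : aeval (fun i : Fin 5 => ξ i.castSucc) P = 0 := by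
      rw [h1]
      exact mul_eq_zero_of_right _ hp
    rw [← hξ] at h3
    have := map_dvd τ (hker _ h3)
    rw [hτF, zero_dvd_iff, hτr, map_eq_zero_iff _ hι, h2] at this
    exact this
  have hσd : ∀ P, σ (dehom P) = aeval u5 P := aeval_dehom u5 hu50
  let φ : L →ₐ[ℂ] M := IsFractionRing.liftAlgHom hσ
  have hφ : ∀ p, φ (ι p) = σ p := fun p => IsFractionRing.lift_algebraMap hσ p
  have hw : ∀ P : MvPolynomial (Fin 6) ℂ, ∀ d, P.IsWeightedHomogeneous w6 d →
      aeval ξ P = ξ 0 ^ d * aeval u P := fun P d hP => scaling_div hP _ h0 ξ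
  -- all of `u` is in the range
  have hur : ∀ i, u i ∈ φ.range := by
    intro i
    have hc : ∀ i : Fin 5, u i.castSucc ∈ φ.range := fun i =>
      ⟨ι (dehom (X i)), by
        change φ _ = _
        rw [hφ, hσd, aeval_X, hu5]⟩
    refine Fin.lastCases ?_ hc i
    refine ⟨s, ?_⟩
    change φ s = _
    have hF : aeval (fun i : Fin 5 => ξ i.castSucc) (f4 h) +
        algebraMap ℂ M t * aeval (fun i : Fin 5 => ξ i.castSucc) g3 * ξ 5 = 0 := by
      have hC : aeval ξ (C t : MvPolynomial (Fin 6) ℂ) = algebraMap ℂ M t :=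
        (aeval ξ).commutes t
      rw [famPoly, map_add, map_mul, map_mul, hξ, hξ, aeval_X, hC] at hrel
      exact hrel
    have hg := scaling_div hg3hom (ξ 0) h0 (fun i : Fin 5 => ξ i.castSucc)
    have hf : aeval (fun i : Fin 5 => ξ i.castSucc) (f4 h) = ξ 0 ^ 4 * aeval u5 (f4 h) := by
      rw [← f4_hom h hh]
      congr 2
      funext i
      simp only [u5]; field_simp
    change _ = ξ 0 ^ 3 * aeval u5 g3 at hg
    rw [hf, hg] at hF
    have hgu : aeval u5 g3 ≠ 0 := by
      rw [← hσd, ← hφ]; exact (map_ne_zero φ).mpr hgL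
    have htM : algebraMap ℂ M t ≠ 0 := by simpa using ht
    have hs' := congrArg φ hs
    rw [map_add, map_mul, map_mul, map_zero, hφ, hφ, hσd, hσd, AlgHom.commutes] at hs'
    change _ = ξ 5 / ξ 0 ^ 1
    rw [pow_one, eq_div_iff h0]
    apply mul_left_cancel₀ (mul_ne_zero (pow_ne_zero 3 h0) (mul_ne_zero htM hgu))
    linear_combination ξ 0 ^ 4 * hs' - hF
  have hPr : ∀ P : MvPolynomial (Fin 6) ℂ, aeval u P ∈ φ.range := by
    intro P
    induction P using MvPolynomial.induction_on with
    | C a => rw [aeval_C]; exact φ.range.algebraMap_mem a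
    | add p q hp hq => rw [map_add]; exact add_mem hp hq
    | mul_X p i hp => rw [map_mul, aeval_X]; exact mul_mem hp (hur i)
  -- closure properties of the set of homogeneous fractions
  have hpoly : ∀ p : MvPolynomial (Fin 4) ℂ, ∃ (P : MvPolynomial (Fin 6) ℂ) (d : ℕ),
      P.IsWeightedHomogeneous w6 d ∧ σ p * ξ 0 ^ d = aeval ξ P := by
    have hX0 : ∀ N : ℕ, (X 0 ^ N : MvPolynomial (Fin 6) ℂ).IsWeightedHomogeneous w6 N := by
      intro N
      have := (isWeightedHomogeneous_X ℂ w6 0).pow N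
      simpa [w6] using this
    intro p
    induction p using MvPolynomial.induction_on with
    | C a => exact ⟨C a, 0, isWeightedHomogeneous_C _ _, by simp [σ]⟩
    | add p q hp hq =>
      obtain ⟨P, d, h1, h2⟩ := hp
      obtain ⟨Q, e, h3, h4⟩ := hq
      refine ⟨P * X 0 ^ e + X 0 ^ d * Q, d + e, (h1.mul (hX0 e)).add ((hX0 d).mul h3), ?_⟩
      simp only [map_add, map_mul, map_pow, aeval_X, ← h2, ← h4]; ring
    | mul_X p i hp =>
      obtain ⟨P, d, h1, h2⟩ := hp
      refine ⟨P * X i.succ.castSucc, d + w6 i.succ.castSucc,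
        h1.mul (isWeightedHomogeneous_X ℂ w6 _), ?_⟩
      simp only [map_mul, aeval_X, ← h2, σ]
      rw [← hu5]
      simp only [u]
      field_simp
      ring
  refine ⟨φ, fun z => ⟨?_, ?_⟩⟩
  · rintro ⟨x, rfl⟩
    obtain ⟨a, b, hb, rfl⟩ := IsFractionRing.div_surjective (A := MvPolynomial (Fin 4) ℂ) x
    obtain ⟨P, d, h1, h2⟩ := hpoly a
    obtain ⟨Q, e, h3, h4⟩ := hpoly b
    have hb' : σ b ≠ 0 := by
      rw [Ne, map_eq_zero_iff _ hσ]; exact nonZeroDivisors.ne_zero hb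
    have hX0 : ∀ N : ℕ, (X 0 ^ N : MvPolynomial (Fin 6) ℂ).IsWeightedHomogeneous w6 N := by
      intro N
      have := (isWeightedHomogeneous_X ℂ w6 0).pow N
      simpa [w6] using this
    refine ⟨P * X 0 ^ e, X 0 ^ d * Q, d + e, h1.mul (hX0 e), (hX0 d).mul h3, ?_, ?_⟩
    · simp only [map_mul, map_pow, aeval_X, ← h4]
      exact mul_ne_zero (pow_ne_zero _ h0) (mul_ne_zero hb' (pow_ne_zero _ h0))
    · have : φ (algebraMap _ L a / algebraMap _ L b) = σ a / σ b := by
        rw [map_div₀]; exact congrArg₂ _ (hφ a) (hφ b)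
      change φ (algebraMap _ L a / algebraMap _ L b) * _ = _
      rw [this]
      simp only [map_mul, map_pow, aeval_X, ← h4, ← h2]
      field_simp
  · rintro ⟨p, q, d, hp, hq, hq0, e⟩
    rw [hw p d hp, hw q d hq] at e
    rw [hw q d hq] at hq0
    have hq1 : aeval u q ≠ 0 := right_ne_zero_of_mul hq0
    have hz : z = aeval u p / aeval u q := by
      rw [eq_div_iff hq1]
      apply mul_left_cancel₀ (pow_ne_zero d h0)
      linear_combination e
    obtain ⟨a, ha⟩ := hPr p
    obtain ⟨b, hb⟩ := hPr q
    refine ⟨a / b, ?_⟩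
    rw [hz, ← ha, ← hb]
    exact map_div₀ φ a b

/-- Let `h ∈ ℂ[x₀,…,x₃]` be homogeneous of degree `4`, not a square, set
`f₄ = x₄² − h`, and let `g₃ ∈ ℂ[x₀,…,x₄]` be nonzero and weighted-homogeneous of degree
`3` for the weights `(1,1,1,1,2)`.  For every `t ≠ 0`, the degree-zero homogeneous
fraction field `K₀(ℂ[x₀,…,x₅]/(f₄ + t·g₃·x₅))`, taken with respect to the weights
`(1,1,1,1,2,1)`, is isomorphic as a `ℂ`-algebra to the rational function field
`ℂ(y₁,y₂,y₃,y₄)` in four variables: the fibers `X_t` for `t ≠ 0` are rational fourfolds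
(Lemma 2.2(2) of the paper). -/
theorem statement7 (h : MvPolynomial (Fin 4) ℂ) (hh : h.IsHomogeneous 4)
    (hsq : ¬ ∃ q : MvPolynomial (Fin 4) ℂ, h = q ^ 2)
    (g3 : MvPolynomial (Fin 5) ℂ) (hg3 : g3 ≠ 0) (hg3hom : g3.IsWeightedHomogeneous w5 3)
    (t : ℂ) (ht : t ≠ 0) :
    Nonempty (↥(K0Quot w6 (famPoly h g3 t)) ≃ₐ[ℂ]
      FractionRing (MvPolynomial (Fin 4) ℂ)) := by
  have hP := prime_fam h hh hsq g3 hg3 hg3hom t ht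
  have hI : (Ideal.span {famPoly h g3 t}).IsPrime :=
    (Ideal.span_singleton_prime hP.ne_zero).mpr hP
  have : IsDomain (MvPolynomial (Fin 6) ℂ ⧸ Ideal.span {famPoly h g3 t}) :=
    Ideal.Quotient.isDomain _
  let A := MvPolynomial (Fin 6) ℂ ⧸ Ideal.span {famPoly h g3 t}
  let M := FractionRing A
  let π : MvPolynomial (Fin 6) ℂ →ₐ[ℂ] M :=
    (IsScalarTower.toAlgHom ℂ A M).comp (Ideal.Quotient.mkₐ ℂ _)
  have hinj : Function.Injective (algebraMap A M) := IsFractionRing.injective A M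
  have hπ : ∀ P, π P = algebraMap A M (Ideal.Quotient.mk _ P) := fun P => rfl
  have hae : aeval (fun i => π (X i)) = π := by ext i : 1; simp
  have hπ0 : ∀ P, π P = 0 ↔ famPoly h g3 t ∣ P := by
    intro P
    rw [hπ, map_eq_zero_iff _ hinj, Ideal.Quotient.eq_zero_iff_mem, Ideal.mem_span_singleton]
  obtain ⟨φ, hφ⟩ := core h g3 hg3 hg3hom t ht (fun i => π (X i))
    (by rw [hae]; exact (hπ0 _).mpr dvd_rfl) hh
    (by intro P hp; rw [hae] at hp; exact (hπ0 _).mp hp)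
  have hr : φ.range = K0Quot w6 (famPoly h g3 t) := by
    ext z
    rw [hφ, hae]
    constructor
    · rintro ⟨p, q, d, hp, hq, hq0, e⟩
      refine Or.inr ⟨_, _, d, ⟨p, hp, rfl⟩, ⟨q, hq, rfl⟩, ?_, e⟩
      rw [mem_nonZeroDivisors_iff_ne_zero]
      intro h0
      exact hq0 (by rw [hπ, h0, map_zero])
    · rintro (rfl | ⟨a, b, d, ⟨p, hp, rfl⟩, ⟨q, hq, rfl⟩, hb, e⟩)
      · exact ⟨0, 1, 0, isWeightedHomogeneous_zero _ _ _, isWeightedHomogeneous_one _ _,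
          by simp, by simp⟩
      · refine ⟨p, q, d, hp, hq, ?_, e⟩
        rw [hπ, Ne, map_eq_zero_iff _ hinj]
        exact nonZeroDivisors.ne_zero hb
  exact ⟨((AlgEquiv.ofInjective φ φ.toRingHom.injective).trans
    (Subalgebra.equivOfEq _ _ hr)).symm⟩
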